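/- Let d ≥ 2 and let A, B ⊆ ℤ^d be finite, nonempty, connected sets with d_∞(A,B) > 1. Then exactly one of the following holds: (i) A ⊆ fill(B) and d(fill(A),B) > 1; (ii) B ⊆ fill(A) and d(fill(B),A) > 1; (iii) d_∞(fill(A),fill(B)) > 1. -/

import Mathlib

/-- Points of `ℤ^d`. -/
abbrev Pt (d : ℕ) := Fin d → ℤ

namespace RI

variable {d : ℕ}

/-- `l¹` distance between two points (ℕ-valued). -/
def n1 (x y : Pt d) : ℕ := ∑ j, (x j - y j).natAbs

/-- `l∞` distance between two points (ℕ-valued). -/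
def ninf (x y : Pt d) : ℕ := Finset.univ.sup fun j => (x j - y j).natAbs

/-- nearest-neighbor adjacency: `‖x - y‖₁ = 1` -/
def adj (x y : Pt d) : Prop := n1 x y = 1

/-- `*`-adjacency: `‖x - y‖_∞ = 1` -/
def adjStar (x y : Pt d) : Prop := ninf x y = 1

/-- `τ` is a nearest-neighbor path of length `N`. -/
def IsPath (τ : ℕ → Pt d) (N : ℕ) : Prop := ∀ l < N, adj (τ l) (τ (l + 1))

/-- the range of a path of length `N` -/
def pathRange (τ : ℕ → Pt d) (N : ℕ) : Set (Pt d) := τ '' {l | l ≤ N}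

/-- `x` and `y` are joined by a nearest-neighbor path all of whose points lie in `U`. -/
def ConnIn (U : Set (Pt d)) (x y : Pt d) : Prop :=
  ∃ τ N, IsPath τ N ∧ τ 0 = x ∧ τ N = y ∧ ∀ l ≤ N, τ l ∈ U

/-- a set is connected: any two of its points are joined by a path inside it -/
def ConnSet (A : Set (Pt d)) : Prop := ∀ x ∈ A, ∀ y ∈ A, ConnIn A x y

/-- the connected component of `U` containing `x` -/
def comp (U : Set (Pt d)) (x : Pt d) : Set (Pt d) := {y | ConnIn U x y}

/-- the (outer) boundary `∂K` -/
def bd (K : Set (Pt d)) : Set (Pt d) := {x | x ∉ K ∧ ∃ y ∈ K, adj x y}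

/-- the `*`-boundary `∂*K` -/
def bdStar (K : Set (Pt d)) : Set (Pt d) := {x | x ∉ K ∧ ∃ y ∈ K, adjStar x y}

/-- the interior boundary `∂_int K` -/
def intBd (K : Set (Pt d)) : Set (Pt d) := {x | x ∈ K ∧ ∃ y, y ∉ K ∧ adj x y}

/-- the `l∞` diameter of a set, valued in `ℕ∞` -/
noncomputable def diam (K : Set (Pt d)) : ℕ∞ := ⨆ x ∈ K, ⨆ y ∈ K, (ninf x y : ℕ∞)

/-- the `l¹` distance between `K` and `K'` exceeds `1` -/
def far1 (K K' : Set (Pt d)) : Prop := ∀ x ∈ K, ∀ y ∈ K', 1 < n1 x y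

/-- the `l∞` distance between `K` and `K'` exceeds `1` -/
def farInf (K K' : Set (Pt d)) : Prop := ∀ x ∈ K, ∀ y ∈ K', 1 < ninf x y

/-- `d_∞(K, K') ≤ r` -/
def dInfLE (K K' : Set (Pt d)) (r : ℕ) : Prop := ∃ x ∈ K, ∃ y ∈ K', ninf x y ≤ r

/-- `fill A`: the set of points every connected set around which inside `Aᶜ` is finite;
for `d ≥ 2` and finite `A` this is exactly the complement of the unique infinite
connected component of `Aᶜ`. -/
def fill (A : Set (Pt d)) : Set (Pt d) :=
  {z | ∀ S : Set (Pt d), z ∈ S → S ⊆ Aᶜ → ConnSet S → S.Finite}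

/-- `A₁` and `A₂` are separated by `𝒰` in `B`: `d(A₁,A₂) > 1` and every path in `B`
joining `∂A₁` to `∂A₂` meets `𝒰`. -/
def SeparatedBy (A₁ A₂ 𝒰 B : Set (Pt d)) : Prop :=
  far1 A₁ A₂ ∧
  ∀ τ N, IsPath τ N → (∀ l ≤ N, τ l ∈ B) → τ 0 ∈ bd A₁ → τ N ∈ bd A₂ →
    ∃ l ≤ N, τ l ∈ 𝒰

/-- the scales `L_κ = L₀ (80 L)^κ` -/
def Lscale (L L₀ κ : ℕ) : ℕ := L₀ * (80 * L) ^ κ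

/-- the box `C_{(κ,i)} = (i L_κ + [0, L_κ)^d) ∩ ℤ^d` -/
def boxC (L L₀ κ : ℕ) (i : Pt d) : Set (Pt d) :=
  {x | ∀ j, i j * (Lscale L L₀ κ : ℤ) ≤ x j ∧
    x j < i j * (Lscale L L₀ κ : ℤ) + (Lscale L L₀ κ : ℤ)}

/-- the neighborhood `C_{(κ,i)}^l = ⋃_{‖j‖_∞ < l} C_{(κ, i+j)}` -/
def boxCl (L L₀ κ : ℕ) (i : Pt d) (l : ℕ) : Set (Pt d) :=
  ⋃ j ∈ {j : Pt d | ∀ t, (j t).natAbs < l}, boxC L L₀ κ (i + j)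

/-- the separation event `χ_{(κ,i)}(𝒰) = 1`: there are connected sets
`A₁, A₂ ⊆ C_{(κ,i)}^2` of diameter at least `L_κ / 2` separated by `𝒰` in `C_{(κ,i)}^3` -/
def chi (L L₀ κ : ℕ) (i : Pt d) (𝒰 : Set (Pt d)) : Prop :=
  ∃ A₁ A₂ : Set (Pt d), A₁ ⊆ boxCl L L₀ κ i 2 ∧ A₂ ⊆ boxCl L L₀ κ i 2 ∧
    ConnSet A₁ ∧ ConnSet A₂ ∧
    (Lscale L L₀ κ : ℕ∞) ≤ 2 * diam A₁ ∧ (Lscale L L₀ κ : ℕ∞) ≤ 2 * diam A₂ ∧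
    SeparatedBy A₁ A₂ 𝒰 (boxCl L L₀ κ i 3)

/-- the centered boxes `C^l = [-(l-1)L₀, l L₀)^d ∩ ℤ^d` -/
def boxCen (L₀ l : ℕ) : Set (Pt d) :=
  {x | ∀ j, -(((l : ℤ) - 1) * (L₀ : ℤ)) ≤ x j ∧ x j < (l : ℤ) * (L₀ : ℤ)}

/-- the separation event `χ(𝒰) = 1` for the centered boxes -/
def chi0 (L₀ : ℕ) (𝒰 : Set (Pt d)) : Prop :=
  ∃ A₁ A₂ : Set (Pt d), A₁ ⊆ boxCen L₀ 2 ∧ A₂ ⊆ boxCen L₀ 2 ∧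
    ConnSet A₁ ∧ ConnSet A₂ ∧
    (L₀ : ℕ∞) ≤ 2 * diam A₁ ∧ (L₀ : ℕ∞) ≤ 2 * diam A₂ ∧
    SeparatedBy A₁ A₂ 𝒰 (boxCen L₀ 3)

/-- `A` is `h`-avoidable in `C`: every path in `C` with endpoints outside `A` can be
modified, within `l∞` distance `h` of its range and through `Range(τ) ∪ ∂*A`,
into a path with the same endpoints avoiding `A`. -/
def Avoidable (h : ℝ) (A C : Set (Pt d)) : Prop :=
  ∀ τ N, IsPath τ N → (∀ l ≤ N, τ l ∈ C) → τ 0 ∉ A → τ N ∉ A →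
    ∃ τ' N', IsPath τ' N' ∧ τ' 0 = τ 0 ∧ τ' N' = τ N ∧
      (∀ l ≤ N', τ' l ∉ A) ∧
      (∀ l ≤ N', (∃ k ≤ N, (ninf (τ' l) (τ k) : ℝ) ≤ h) ∧
        (τ' l ∈ pathRange τ N ∨ τ' l ∈ bdStar A))

/-- a doubly infinite transient nearest-neighbor trajectory -/
def IsTraj (w : ℤ → Pt d) : Prop :=
  (∀ l : ℤ, adj (w l) (w (l + 1))) ∧
  Filter.Tendsto (fun l : ℤ => n1 (w l) 0) Filter.cofinite Filter.atTop

/-- `k` is a cut-time of `w`: `d_∞({w(l) : l < k}, {w(l) : l > k}) > 1` -/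
def CutTime (w : ℤ → Pt d) (k : ℤ) : Prop :=
  ∀ l, l < k → ∀ l', k < l' → 1 < ninf (w l) (w l')

/-- the `j`-th sausage `𝒰_j = {w(l) : n_j < l < n_{j+1}}` -/
def sausage (w : ℤ → Pt d) (n : ℕ → ℤ) (j : ℕ) : Set (Pt d) :=
  w '' {l | n j < l ∧ l < n (j + 1)}

/-- boxes: products of integer intervals -/
def IsBox (B : Set (Pt d)) : Prop :=
  ∃ a b : Pt d, B = {x | ∀ j, a j ≤ x j ∧ x j ≤ b j}

/-- the smallest box containing `K` -/
def sbox (K : Set (Pt d)) : Set (Pt d) := ⋂₀ {B | IsBox B ∧ K ⊆ B}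

/-- the closed `l∞` ball `B(x, r)` -/
def ball (x : Pt d) (r : ℕ) : Set (Pt d) := {y | ninf x y ≤ r}

/-- a skeleton: a set of indices at the finest scale satisfying the Wiener-type
spacing conditions -/
def IsSkeleton (L L₀ : ℕ) (M : Finset (Pt d)) : Prop :=
  ∀ m₀ ∈ M,
    (∀ h : ℕ,
      {m : Pt d | m ∈ M ∧
        dInfLE (boxC L L₀ 0 m₀) (boxC L L₀ 0 m) (L * Lscale L L₀ (h + 1)) ∧
        ¬ dInfLE (boxC L L₀ 0 m₀) (boxC L L₀ 0 m) (L * Lscale L L₀ h)}.ncard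
        ≤ 2 ^ (h + 1)) ∧
    ∀ m ∈ M, m ≠ m₀ → ¬ dInfLE (boxC L L₀ 0 m₀) (boxC L L₀ 0 m) (L * Lscale L L₀ 0)

theorem n1_comm (x y : Pt d) : n1 x y = n1 y x :=
  Finset.sum_congr rfl fun j _ => by omega

theorem adj.symm {x y : Pt d} (h : adj x y) : adj y x := by
  rw [adj, n1_comm]; exact h

theorem ninf_le_iff {x y : Pt d} {r : ℕ} : ninf x y ≤ r ↔ ∀ j, (x j - y j).natAbs ≤ r := by
  simp [ninf, Finset.sup_le_iff]

theorem ninf_comm (x y : Pt d) : ninf x y = ninf y x :=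
  Finset.sup_congr rfl fun j _ => by omega

theorem ninf_le_n1 (x y : Pt d) : ninf x y ≤ n1 x y :=
  ninf_le_iff.2 fun j =>
    Finset.single_le_sum (f := fun j => (x j - y j).natAbs) (fun _ _ => Nat.zero_le _)
      (Finset.mem_univ j)

theorem n1_update_self (x : Pt d) (j : Fin d) (t : ℤ) :
    n1 x (Function.update x j t) = (x j - t).natAbs := by
  rw [n1, Finset.sum_eq_single j]
  · simp
  · intro b _ hb; simp [hb]
  · simp

theorem ConnIn.refl {U : Set (Pt d)} {x : Pt d} (h : x ∈ U) : ConnIn U x x :=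
  ⟨fun _ => x, 0, by simp [IsPath], rfl, rfl, fun _ _ => h⟩

theorem ConnIn.mono {U V : Set (Pt d)} (hUV : U ⊆ V) {x y : Pt d} (h : ConnIn U x y) :
    ConnIn V x y := by
  obtain ⟨τ, N, hp, h0, hN, hU⟩ := h
  exact ⟨τ, N, hp, h0, hN, fun l hl => hUV (hU l hl)⟩

theorem ConnIn.symm {U : Set (Pt d)} {x y : Pt d} (h : ConnIn U x y) : ConnIn U y x := by
  obtain ⟨τ, N, hp, rfl, rfl, hU⟩ := h
  refine ⟨fun l => τ (N - l), N, fun l hl => ?_, by simp, by simp, fun l _ => hU _ (by omega)⟩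
  have h := hp (N - (l + 1)) (by omega)
  rw [show N - (l + 1) + 1 = N - l by omega] at h
  exact h.symm

/-- A path can be prolonged by a step at its start. -/
theorem ConnIn.head {U : Set (Pt d)} {x y z : Pt d} (hx : x ∈ U) (hxy : adj x y)
    (h : ConnIn U y z) : ConnIn U x z := by
  obtain ⟨τ, N, hp, rfl, rfl, hU⟩ := h
  refine ⟨fun l => if l = 0 then x else τ (l - 1), N + 1, fun l hl => ?_, by simp, by simp,
    fun l hl => ?_⟩
  · rcases l with _ | l
    · simpa using hxy
    · simpa using hp l (by omega)
  · rcases l with _ | l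
    · simpa using hx
    · simpa using hU l (by omega)

theorem ConnSet.insert {S : Set (Pt d)} (hS : ConnSet S) {x y : Pt d} (hy : y ∈ S)
    (hxy : adj x y) : ConnSet (insert x S) := by
  have hx : ∀ z ∈ S, ConnIn (Insert.insert x S) x z := fun z hz =>
    ((hS y hy z hz).mono (Set.subset_insert x S)).head (Set.mem_insert x S) hxy
  rintro a (rfl | ha) b (rfl | hb)
  · exact .refl (Set.mem_insert _ S)
  · exact hx b hb
  · exact (hx a ha).symm
  · exact (hS a ha b hb).mono (Set.subset_insert x S)

theorem subset_fill (A : Set (Pt d)) : A ⊆ fill A :=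
  fun _ hz _ hzS hS _ => absurd hz (hS hzS)

/-- Leaving `fill A` is only possible through a point of `A`. -/
theorem mem_fill_of_adj {A : Set (Pt d)} {x y : Pt d} (hx : x ∈ fill A) (hxA : x ∉ A)
    (hxy : adj x y) : y ∈ fill A := fun S hyS hS hSc =>
  (hx (insert x S) (Set.mem_insert x S) (Set.insert_subset hxA hS)
    (hSc.insert hyS hxy)).subset (Set.subset_insert x S)

theorem mem_fill_of_connIn {A : Set (Pt d)} {x y : Pt d} (h : ConnIn Aᶜ x y)
    (hx : x ∈ fill A) : y ∈ fill A := by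
  obtain ⟨τ, N, hp, rfl, rfl, hU⟩ := h
  have key : ∀ l ≤ N, τ l ∈ fill A := by
    intro l
    induction l with
    | zero => exact fun _ => hx
    | succ l ih => exact fun hl => mem_fill_of_adj (ih (by omega)) (hU l (by omega)) (hp l hl)
  exact key N le_rfl

theorem ConnSet.subset_fill {A B : Set (Pt d)} (hB : ConnSet B) (hAB : Disjoint A B)
    {x : Pt d} (hxB : x ∈ B) (hx : x ∈ fill A) : B ⊆ fill A := fun y hy =>
  mem_fill_of_connIn ((hB x hxB y hy).mono hAB.subset_compl_left) hx

/-- The `n`-th point of the ray from `x` in coordinate direction `i`. -/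
def ray (x : Pt d) (i : Fin d) (n : ℕ) : Pt d := Function.update x i (x i + n)

theorem ray_zero (x : Pt d) (i : Fin d) : ray x i 0 = x := by simp [ray]

theorem ray_apply (x : Pt d) (i : Fin d) (n : ℕ) : ray x i n i = x i + n := by simp [ray]

theorem adj_ray (x : Pt d) (i : Fin d) (n : ℕ) : adj (ray x i n) (ray x i (n + 1)) := by
  have h : ray x i (n + 1) = Function.update (ray x i n) i (x i + (n + 1 : ℕ)) := by simp [ray]
  rw [adj, h, n1_update_self, ray_apply]
  push_cast
  omega

theorem connSet_range_ray (x : Pt d) (i : Fin d) : ConnSet (Set.range (ray x i)) := by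
  have key : ∀ m n, m ≤ n → ConnIn (Set.range (ray x i)) (ray x i m) (ray x i n) :=
    fun m n hmn => ⟨fun l => ray x i (m + l), n - m, fun l _ => adj_ray x i (m + l), rfl,
      by simp [hmn], fun l _ => ⟨m + l, rfl⟩⟩
  rintro _ ⟨m, rfl⟩ _ ⟨n, rfl⟩
  rcases le_total m n with h | h
  · exact key m n h
  · exact (key n m h).symm

theorem infinite_range_ray (x : Pt d) (i : Fin d) : (Set.range (ray x i)).Infinite :=
  Set.infinite_range_of_injective fun m n h => by
    have := congrFun h i
    simpa [ray_apply] using this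

theorem notMem_fill_of_ray {A : Set (Pt d)} {x : Pt d} {i : Fin d} (h : ∀ n, ray x i n ∉ A) :
    x ∉ fill A := fun hx =>
  infinite_range_ray x i <| hx _ ⟨0, ray_zero x i⟩
    (by rintro _ ⟨n, rfl⟩; exact h n) (connSet_range_ray x i)

/-- Two disjoint finite sets cannot lie in each other's fillings. -/
theorem not_subset_fill_and_subset_fill (i : Fin d) {A B : Set (Pt d)} (hA : A.Finite)
    (hB : B.Finite) (hne : A.Nonempty) (hAB : Disjoint A B) :
    ¬ (A ⊆ fill B ∧ B ⊆ fill A) := by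
  rintro ⟨h₁, h₂⟩
  obtain ⟨x, hx, hmax⟩ := (hA.union hB).exists_maximalFor (fun z => z i) _ hne.inl
  have hray : ∀ n, ray x i n ∈ A ∪ B → ray x i n = x := by
    intro n hn
    have h := hmax hn (by simp [ray_apply])
    simp only [ray_apply] at h
    obtain rfl : n = 0 := by omega
    exact ray_zero x i
  rcases hx with hx | hx
  · exact notMem_fill_of_ray (i := i)
      (fun n hn => hAB.notMem_of_mem_left hx (hray n (.inr hn) ▸ hn)) (h₁ hx)
  · exact notMem_fill_of_ray (i := i)
      (fun n hn => hAB.notMem_of_mem_right hx (hray n (.inl hn) ▸ hn)) (h₂ hx)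

theorem disjoint_fill (i : Fin d) {A B : Set (Pt d)} (hA : Disjoint A (fill B))
    (hB : Disjoint B (fill A)) : Disjoint (fill A) (fill B) := by
  refine Set.disjoint_left.2 fun z hzA hzB => ?_
  have key : ∀ n, ray z i n ∈ fill A ∧ ray z i n ∈ fill B := by
    intro n
    induction n with
    | zero => simpa [ray_zero] using ⟨hzA, hzB⟩
    | succ n ih =>
      exact ⟨mem_fill_of_adj ih.1 (hA.notMem_of_mem_right ih.2) (adj_ray z i n),
        mem_fill_of_adj ih.2 (hB.notMem_of_mem_right ih.1) (adj_ray z i n)⟩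
  exact notMem_fill_of_ray (fun n => hA.notMem_of_mem_right (key n).2) hzA

/-- Distinct points at `l∞` distance at most `1` admit a neighbor of the first that is
`l¹`-closer to the second, at no larger `l∞` distance bound. -/
theorem exists_adj_closer {x y : Pt d} (hxy : x ≠ y) (h : ninf x y ≤ 1) :
    ∃ x', adj x x' ∧ ninf x' y ≤ 1 ∧ n1 x' y < n1 x y := by
  obtain ⟨j, hj⟩ := Function.ne_iff.1 hxy
  rw [ninf_le_iff] at h
  have hle : ∀ k, (Function.update x j (y j) k - y k).natAbs ≤ (x k - y k).natAbs := by
    intro k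
    rcases eq_or_ne k j with rfl | hk
    · simp
    · simp [hk]
  refine ⟨Function.update x j (y j), ?_, ninf_le_iff.2 fun k => (hle k).trans (h k), ?_⟩
  · rw [adj, n1_update_self]
    have := h j
    omega
  · refine Finset.sum_lt_sum (fun k _ => hle k) ⟨j, Finset.mem_univ j, ?_⟩
    simp only [Function.update_self]
    omega

theorem farInf_fill {A B : Set (Pt d)} (hfar : farInf A B)
    (hdisj : Disjoint (fill A) (fill B)) : farInf (fill A) (fill B) := by
  have key : ∀ n : ℕ, ∀ x ∈ fill A, ∀ y ∈ fill B, n1 x y = n → 1 < ninf x y := by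
    intro n
    induction n using Nat.strong_induction_on with
    | _ n ih =>
      rintro x hx y hy rfl
      by_contra! hle
      have hne : x ≠ y := fun h => Set.disjoint_left.1 hdisj hx (h ▸ hy)
      by_cases hxA : x ∈ A
      · by_cases hyB : y ∈ B
        · exact hle.not_gt (hfar x hxA y hyB)
        · obtain ⟨y', hadj, hinf, hlt⟩ := exists_adj_closer hne.symm (ninf_comm x y ▸ hle)
          rw [n1_comm y' x, n1_comm y x] at hlt
          exact (ninf_comm y' x ▸ hinf).not_gt
            (ih _ hlt x hx y' (mem_fill_of_adj hy hyB hadj) rfl)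
      · obtain ⟨x', hadj, hinf, hlt⟩ := exists_adj_closer hne hle
        exact hinf.not_gt (ih _ hlt x' (mem_fill_of_adj hx hxA hadj) y hy rfl)
  exact fun x hx y hy => key _ x hx y hy rfl

theorem ninf_self (x : Pt d) : ninf x x = 0 :=
  Nat.le_zero.1 (ninf_le_iff.2 (by simp))

theorem farInf.symm {A B : Set (Pt d)} (h : farInf A B) : farInf B A := fun x hx y hy =>
  ninf_comm y x ▸ h y hy x hx

theorem farInf.disjoint {A B : Set (Pt d)} (h : farInf A B) : Disjoint A B :=
  Set.disjoint_left.2 fun x hA hB => by simpa [ninf_self] using h x hA x hB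

theorem far1_fill_left {A B : Set (Pt d)} (hfar : farInf A B) (hdisj : Disjoint B (fill A)) :
    far1 (fill A) B := by
  intro x hx y hy
  by_contra! hle
  have hyA : y ∉ fill A := hdisj.notMem_of_mem_left hy
  have hxA : x ∉ A := fun hxA => ((ninf_le_n1 x y).trans hle).not_gt (hfar x hxA y hy)
  have h0 : n1 x y ≠ 0 := by
    intro h0
    have hxy : x = y := funext fun j => by
      have := ninf_le_iff.1 ((ninf_le_n1 x y).trans h0.le) j
      omega
    exact hyA (hxy ▸ hx)
  exact hyA (mem_fill_of_adj hx hxA (show n1 x y = 1 by omega))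

/-- for finite, nonempty, connected `A, B` with `d_∞(A,B) > 1`,
exactly one of the three alternatives (with `l∞` separation in the third) holds. -/
theorem statement5 (d : ℕ) (hd : 2 ≤ d) (A B : Set (Pt d))
    (hAf : A.Finite) (hBf : B.Finite) (hAne : A.Nonempty) (hBne : B.Nonempty)
    (hAc : ConnSet A) (hBc : ConnSet B) (hfar : farInf A B) :
    ((A ⊆ fill B ∧ far1 (fill A) B) ∧
      ¬(B ⊆ fill A ∧ far1 (fill B) A) ∧ ¬ farInf (fill A) (fill B)) ∨
    (¬(A ⊆ fill B ∧ far1 (fill A) B) ∧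
      (B ⊆ fill A ∧ far1 (fill B) A) ∧ ¬ farInf (fill A) (fill B)) ∨
    (¬(A ⊆ fill B ∧ far1 (fill A) B) ∧
      ¬(B ⊆ fill A ∧ far1 (fill B) A) ∧ farInf (fill A) (fill B)) := by
  have hdisj := hfar.disjoint
  have i : Fin d := ⟨0, by omega⟩
  have hnot := not_subset_fill_and_subset_fill i hAf hBf hAne hdisj
  have hA : A ⊆ fill B ∨ Disjoint A (fill B) := or_iff_not_imp_right.2 fun h => by
    obtain ⟨x, hxA, hx⟩ := Set.not_disjoint_iff.1 h
    exact hAc.subset_fill hdisj.symm hxA hx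
  have hB : B ⊆ fill A ∨ Disjoint B (fill A) := or_iff_not_imp_right.2 fun h => by
    obtain ⟨x, hxB, hx⟩ := Set.not_disjoint_iff.1 h
    exact hBc.subset_fill hdisj hxB hx
  have hA' : A ⊆ fill B → ¬ farInf (fill A) (fill B) := fun h hf => by
    obtain ⟨x, hx⟩ := hAne
    exact hf.disjoint.notMem_of_mem_left (subset_fill A hx) (h hx)
  have hB' : B ⊆ fill A → ¬ farInf (fill A) (fill B) := fun h hf => by
    obtain ⟨x, hx⟩ := hBne
    exact hf.disjoint.notMem_of_mem_left (h hx) (subset_fill B hx)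
  rcases hA with hA | hA <;> rcases hB with hB | hB
  · exact absurd ⟨hA, hB⟩ hnot
  · exact .inl ⟨⟨hA, far1_fill_left hfar hB⟩, fun h => hnot ⟨hA, h.1⟩, hA' hA⟩
  · exact .inr (.inl ⟨fun h => hnot ⟨h.1, hB⟩, ⟨hB, far1_fill_left hfar.symm hA⟩, hB' hB⟩)
  · have hf := farInf_fill hfar (disjoint_fill i hA hB)
    exact .inr (.inr ⟨fun h => hA' h.1 hf, fun h => hB' h.1 hf, hf⟩)

end RI
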